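/- Fix observations y_0 ∈ Y_0, …, y_n ∈ Y_n with p^Y_{[n]}(y_0, …, y_n) > 0, and let B_t and q_t be the instantiated Bayes filter quantities for these observations. Define the instantiated fixed-interval smoother backwards by ŝ_n := B_n and, for 0 ≤ t < n, ŝ_t(x) := B_t(x) · Σ_{x' ∈ X_{t+1}} f_{t+1}(x' | x) · ŝ_{t+1}(x') / q_{t+1}(x'), where summands with q_{t+1}(x') = 0 are interpreted as 0. Then the fixed-interval smoothing recursion is correct: for every 0 ≤ t ≤ n and x ∈ X_t, ŝ_t(x) = P_p(X_t = x | Y_0 = y_0, …, Y_n = y_n). -/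

import Mathlib

open scoped ENNReal Classical

namespace DiscreteHMM

variable {n : ℕ}

/-- The joint distribution of a discrete hidden Markov model with initial distribution
`f₀`, transition kernels `f` and observation kernels `g`. -/
noncomputable def hmmJoint {X Y : Fin (n+1) → Type*}
    (f₀ : PMF (X 0)) (f : ∀ t : Fin n, X t.castSucc → PMF (X t.succ))
    (g : ∀ t : Fin (n+1), X t → PMF (Y t)) (ω : ∀ t, X t × Y t) : ℝ≥0∞ :=
  f₀ (ω 0).1 * g 0 (ω 0).1 (ω 0).2 *
    ∏ t : Fin n, (f t (ω t.castSucc).1 (ω t.succ).1 * g t.succ (ω t.succ).1 (ω t.succ).2)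

/-- Probability of the event `E` under the probability mass function `p` on a finite
type. -/
noncomputable def prob {Ω : Type*} [Fintype Ω] (p : Ω → ℝ≥0∞) (E : Set Ω) : ℝ≥0∞ :=
  ∑ ω, E.indicator p ω

variable {X Y : Fin (n+1) → Type*} [∀ i, Fintype (X i)] [∀ i, Fintype (Y i)]
  [∀ i, Nonempty (X i)] [∀ i, Nonempty (Y i)]

/-- The instantiated Bayes filter `B_t` for the observation sequence `y`, computed by the
recursion `B_t(x) = g_t(y_t|x) · q_t(x) / (Σ_{x'} g_t(y_t|x') · q_t(x'))` where
`q_0 = f₀` and `q_t(x) = Σ_{x'} f_t(x|x') · B_{t-1}(x')`. -/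
noncomputable def bayesFilter (f₀ : PMF (X 0))
    (f : ∀ t : Fin n, X t.castSucc → PMF (X t.succ))
    (g : ∀ t : Fin (n+1), X t → PMF (Y t)) (y : ∀ t, Y t) :
    ∀ t : Fin (n+1), X t → ℝ≥0∞ :=
  Fin.induction
    (fun x => g 0 x (y 0) * f₀ x / ∑ x', g 0 x' (y 0) * f₀ x')
    (fun i ih x =>
      g i.succ x (y i.succ) * (∑ x', f i x' x * ih x') /
        ∑ x'', g i.succ x'' (y i.succ) * ∑ x', f i x' x'' * ih x')

/-- The predicted ("prediction step") distribution `q_t` of the instantiated Bayes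
filter: `q_0 = f₀` and `q_t(x) = Σ_{x'} f_t(x|x') · B_{t-1}(x')`. -/
noncomputable def bayesPredict (f₀ : PMF (X 0))
    (f : ∀ t : Fin n, X t.castSucc → PMF (X t.succ))
    (g : ∀ t : Fin (n+1), X t → PMF (Y t)) (y : ∀ t, Y t) :
    ∀ t : Fin (n+1), X t → ℝ≥0∞ :=
  Fin.cases (fun x => f₀ x)
    (fun i x => ∑ x', f i x' x * bayesFilter f₀ f g y i.castSucc x')

/-- The instantiated fixed-interval smoother, computed by the backwards recursion
`ŝ_n = B_n` and `ŝ_t(x) = B_t(x) · Σ_{x'} f_{t+1}(x'|x) · ŝ_{t+1}(x') / q_{t+1}(x')`,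
where summands with `q_{t+1}(x') = 0` are interpreted as `0`. -/
noncomputable def smoother (f₀ : PMF (X 0))
    (f : ∀ t : Fin n, X t.castSucc → PMF (X t.succ))
    (g : ∀ t : Fin (n+1), X t → PMF (Y t)) (y : ∀ t, Y t) :
    ∀ t : Fin (n+1), X t → ℝ≥0∞ :=
  Fin.reverseInduction (fun x => bayesFilter f₀ f g y (Fin.last n) x)
    (fun i ih x =>
      bayesFilter f₀ f g y i.castSucc x *
        ∑ x' : X i.succ,
          if bayesPredict f₀ f g y i.succ x' = 0 then 0
          else f i x x' * ih x' / bayesPredict f₀ f g y i.succ x')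

/-- Summing a product of transition weights over all paths, with a weight on the initial state,
contracts to a single sum against the backward message at time `0`. -/
theorem sum_path_eq_sum_mul_backward : ∀ {n : ℕ} {S : Fin (n+1) → Type*} [∀ i, Fintype (S i)]
    (k : ∀ i : Fin n, S i.castSucc → S i.succ → ℝ≥0∞) (b : ∀ t, S t → ℝ≥0∞)
    (_ : ∀ z, b (Fin.last n) z = 1)
    (_ : ∀ (i : Fin n) (z : S i.castSucc), b i.castSucc z = ∑ z', k i z z' * b i.succ z')
    (h : S 0 → ℝ≥0∞),
    ∑ p : ∀ t, S t, h (p 0) * ∏ i : Fin n, k i (p i.castSucc) (p i.succ) = ∑ z, h z * b 0 z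
  | 0, S, _, k, b, hlast, _, h => by
    rw [← (Fin.consEquiv S).sum_comp, Fintype.sum_prod_type]
    refine Finset.sum_congr rfl fun z _ => ?_
    have hz : b 0 z = 1 := hlast z
    simp [Fin.consEquiv, hz]
  | n + 1, S, _, k, b, hlast, hb, h => by
    rw [← (Fin.consEquiv S).sum_comp, Fintype.sum_prod_type]
    refine Finset.sum_congr rfl fun z _ => ?_
    have hz : b 0 z = ∑ z' : S (Fin.succ 0), k 0 z z' * b (Fin.succ 0) z' := hb 0 z
    rw [hz, ← sum_path_eq_sum_mul_backward (S := fun t => S t.succ) (fun i => k i.succ)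
      (fun t => b t.succ) hlast (fun i => hb i.succ) (fun z' => k 0 z z'), Finset.mul_sum]
    refine Finset.sum_congr rfl fun p _ => ?_
    rw [Fin.prod_univ_succ]
    rfl

/-- The total weight of the paths through a given state at time `t` is the product of the forward
and backward messages at that state. -/
theorem sum_path_through_eq_mul : ∀ {n : ℕ} {S : Fin (n+1) → Type*} [∀ i, Fintype (S i)]
    (k : ∀ i : Fin n, S i.castSucc → S i.succ → ℝ≥0∞) (a b : ∀ t, S t → ℝ≥0∞)
    (_ : ∀ (i : Fin n) (z' : S i.succ), a i.succ z' = ∑ z, a i.castSucc z * k i z z')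
    (_ : ∀ z, b (Fin.last n) z = 1)
    (_ : ∀ (i : Fin n) (z : S i.castSucc), b i.castSucc z = ∑ z', k i z z' * b i.succ z')
    (t : Fin (n+1)) (x : S t),
    (∑ p : ∀ t, S t, if p t = x then a 0 (p 0) * ∏ i : Fin n, k i (p i.castSucc) (p i.succ) else 0)
      = a t x * b t x := by
  intro n
  induction n with
  | zero =>
    intro S _ k a b ha hlast hb t x
    obtain rfl : t = 0 := Fin.fin_one_eq_zero t
    have := sum_path_eq_sum_mul_backward k b hlast hb (fun z => if z = x then a 0 z else 0)
    simpa [ite_mul] using this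
  | succ n ih =>
    intro S _ k a b ha hlast hb t x
    cases t using Fin.cases with
    | zero =>
      have := sum_path_eq_sum_mul_backward k b hlast hb (fun z => if z = x then a 0 z else 0)
      simpa [ite_mul] using this
    | succ s =>
      rw [← ih (S := fun t => S t.succ) (fun i => k i.succ) (fun t => a t.succ)
        (fun t => b t.succ) (fun i => ha i.succ) hlast (fun i => hb i.succ) s x,
        ← (Fin.consEquiv S).sum_comp, Fintype.sum_prod_type_right]
      refine Finset.sum_congr rfl fun p _ => ?_
      have hp : a (Fin.succ 0) (p 0) = ∑ z : S 0, a 0 z * k 0 z (p 0) := ha 0 (p 0)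
      change (∑ z : S 0, if p s = x then a 0 z * ∏ i : Fin (n+1), k i
        ((Fin.cons z p : ∀ t, S t) i.castSucc) (p i) else 0) = _
      split_ifs with hx
      · rw [hp, Finset.sum_mul]
        refine Finset.sum_congr rfl fun z _ => ?_
        rw [Fin.prod_univ_succ, mul_assoc]
        rfl
      · simp

section Filter

variable {S O : Fin (n+1) → Type*} [∀ i, Fintype (S i)]

variable (f₀ : PMF (S 0)) (f : ∀ t : Fin n, S t.castSucc → PMF (S t.succ))
  (g : ∀ t : Fin (n+1), S t → PMF (O t)) (y : ∀ t, O t)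

/-- The normalising constant of the Bayes filter at time `t`. -/
noncomputable def bayesEvidence (t : Fin (n+1)) : ℝ≥0∞ :=
  ∑ x, g t x (y t) * bayesPredict f₀ f g y t x

/-- The unnormalised transition weight from time `i` to `i + 1`, divided by the normalising
constant of the Bayes filter. -/
noncomputable def filterKernel (i : Fin n) (x : S i.castSucc) (x' : S i.succ) : ℝ≥0∞ :=
  f i x x' * g i.succ x' (y i.succ) / bayesEvidence f₀ f g y i.succ

/-- The backward message associated with `filterKernel`. -/
noncomputable def backwardMessage : ∀ t : Fin (n+1), S t → ℝ≥0∞ :=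
  Fin.reverseInduction (fun _ => 1)
    (fun i ih x => ∑ x', filterKernel f₀ f g y i x x' * ih x')

theorem backwardMessage_last (x : S (Fin.last n)) :
    backwardMessage f₀ f g y (Fin.last n) x = 1 := by
  simp [backwardMessage]

theorem backwardMessage_castSucc (i : Fin n) (x : S i.castSucc) :
    backwardMessage f₀ f g y i.castSucc x =
      ∑ x', filterKernel f₀ f g y i x x' * backwardMessage f₀ f g y i.succ x' := by
  simp [backwardMessage]

theorem smoother_last (x : S (Fin.last n)) :
    smoother f₀ f g y (Fin.last n) x = bayesFilter f₀ f g y (Fin.last n) x := by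
  simp [smoother]

theorem smoother_castSucc (i : Fin n) (x : S i.castSucc) :
    smoother f₀ f g y i.castSucc x = bayesFilter f₀ f g y i.castSucc x *
      ∑ x' : S i.succ, if bayesPredict f₀ f g y i.succ x' = 0 then 0
        else f i x x' * smoother f₀ f g y i.succ x' / bayesPredict f₀ f g y i.succ x' := by
  simp [smoother]

theorem bayesPredict_succ (i : Fin n) (x : S i.succ) :
    bayesPredict f₀ f g y i.succ x = ∑ x', f i x' x * bayesFilter f₀ f g y i.castSucc x' :=
  rfl

theorem bayesFilter_eq (t : Fin (n+1)) (x : S t) :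
    bayesFilter f₀ f g y t x =
      g t x (y t) * bayesPredict f₀ f g y t x / bayesEvidence f₀ f g y t := by
  cases t using Fin.cases <;> rfl

theorem bayesFilter_le_one (t : Fin (n+1)) (x : S t) : bayesFilter f₀ f g y t x ≤ 1 := by
  rw [bayesFilter_eq]
  refine ENNReal.div_le_of_le_mul ?_
  rw [one_mul]
  exact Finset.single_le_sum (f := fun x => g t x (y t) * bayesPredict f₀ f g y t x)
    (fun _ _ => zero_le) (Finset.mem_univ x)

theorem bayesPredict_ne_top (t : Fin (n+1)) (x : S t) : bayesPredict f₀ f g y t x ≠ ⊤ := by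
  cases t using Fin.cases with
  | zero => exact f₀.apply_ne_top x
  | succ i =>
    rw [bayesPredict_succ]
    exact ENNReal.sum_ne_top.2 fun x' _ => ENNReal.mul_ne_top ((f i x').apply_ne_top x)
      (ne_top_of_le_ne_top ENNReal.one_ne_top (bayesFilter_le_one f₀ f g y _ x'))

theorem bayesEvidence_ne_top (t : Fin (n+1)) : bayesEvidence f₀ f g y t ≠ ⊤ :=
  ENNReal.sum_ne_top.2 fun x _ => ENNReal.mul_ne_top ((g t x).apply_ne_top _)
    (bayesPredict_ne_top f₀ f g y t x)

theorem bayesFilter_succ (i : Fin n) (x' : S i.succ) :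
    bayesFilter f₀ f g y i.succ x' =
      ∑ x, bayesFilter f₀ f g y i.castSucc x * filterKernel f₀ f g y i x x' := by
  rw [bayesFilter_eq, bayesPredict_succ, Finset.mul_sum, div_eq_mul_inv, Finset.sum_mul]
  refine Finset.sum_congr rfl fun x _ => ?_
  rw [filterKernel, div_eq_mul_inv]
  ring

theorem smoother_eq_mul_backwardMessage (t : Fin (n+1)) (x : S t) :
    smoother f₀ f g y t x = bayesFilter f₀ f g y t x * backwardMessage f₀ f g y t x := by
  induction t using Fin.reverseInduction with
  | last => rw [smoother_last, backwardMessage_last, mul_one]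
  | cast i ih =>
    rw [smoother_castSucc, backwardMessage_castSucc, Finset.mul_sum, Finset.mul_sum]
    refine Finset.sum_congr rfl fun x' _ => ?_
    split_ifs with hq
    · have h0 : f i x x' * bayesFilter f₀ f g y i.castSucc x = 0 := by
        rw [bayesPredict_succ] at hq
        exact Finset.sum_eq_zero_iff.1 hq x (Finset.mem_univ x)
      rw [filterKernel, div_eq_mul_inv, mul_zero]
      calc 0 = (f i x x' * bayesFilter f₀ f g y i.castSucc x) * (g i.succ x' (y i.succ) *
            (bayesEvidence f₀ f g y i.succ)⁻¹ * backwardMessage f₀ f g y i.succ x') := by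
              rw [h0, zero_mul]
        _ = _ := by ring
    · rw [ih, bayesFilter_eq f₀ f g y i.succ, filterKernel]
      simp only [div_eq_mul_inv]
      calc _ = bayesFilter f₀ f g y i.castSucc x * (f i x x' * g i.succ x' (y i.succ) *
            (bayesEvidence f₀ f g y i.succ)⁻¹ * backwardMessage f₀ f g y i.succ x') *
            (bayesPredict f₀ f g y i.succ x' * (bayesPredict f₀ f g y i.succ x')⁻¹) := by ring
        _ = _ := by
            rw [ENNReal.mul_inv_cancel hq (bayesPredict_ne_top f₀ f g y _ x'), mul_one]

/-- A state on a path of positive joint weight has positive weight before normalisation. -/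
theorem mul_bayesPredict_ne_zero {x : ∀ t, S t}
    (hx : hmmJoint f₀ f g (fun t => (x t, y t)) ≠ 0) (t : Fin (n+1)) :
    g t (x t) (y t) * bayesPredict f₀ f g y t (x t) ≠ 0 := by
  obtain ⟨h0, hprod⟩ := mul_ne_zero_iff.1 hx
  rw [Finset.prod_ne_zero_iff] at hprod
  induction t using Fin.induction with
  | zero => exact mul_comm (f₀ (x 0)) _ ▸ h0
  | succ i ih =>
    obtain ⟨hf, hg⟩ := mul_ne_zero_iff.1 (hprod i (Finset.mem_univ i))
    refine mul_ne_zero hg fun hq => ?_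
    rw [bayesPredict_succ] at hq
    have h := Finset.sum_eq_zero_iff.1 hq (x i.castSucc) (Finset.mem_univ _)
    refine mul_ne_zero hf ?_ h
    rw [bayesFilter_eq]
    exact ENNReal.div_ne_zero.2 ⟨ih, bayesEvidence_ne_top f₀ f g y _⟩

theorem hmmJoint_eq_prod_bayesEvidence_mul (hD : ∀ t, bayesEvidence f₀ f g y t ≠ 0)
    (x : ∀ t, S t) :
    hmmJoint f₀ f g (fun t => (x t, y t)) = (∏ t, bayesEvidence f₀ f g y t) *
      (bayesFilter f₀ f g y 0 (x 0) *
        ∏ i : Fin n, filterKernel f₀ f g y i (x i.castSucc) (x i.succ)) := by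
  have h0 : f₀ (x 0) * g 0 (x 0) (y 0) =
      bayesEvidence f₀ f g y 0 * bayesFilter f₀ f g y 0 (x 0) := by
    rw [bayesFilter_eq, ENNReal.mul_div_cancel (hD 0) (bayesEvidence_ne_top f₀ f g y 0), mul_comm]
    rfl
  have hs (i : Fin n) : f i (x i.castSucc) (x i.succ) * g i.succ (x i.succ) (y i.succ) =
      bayesEvidence f₀ f g y i.succ * filterKernel f₀ f g y i (x i.castSucc) (x i.succ) := by
    rw [filterKernel, ENNReal.mul_div_cancel (hD _) (bayesEvidence_ne_top f₀ f g y _)]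
  simp only [hmmJoint, h0, hs, Finset.prod_mul_distrib, Fin.prod_univ_succ]
  ring

theorem sum_bayesFilter_eq_one (hD : ∀ t, bayesEvidence f₀ f g y t ≠ 0) (t : Fin (n+1)) :
    ∑ x, bayesFilter f₀ f g y t x = 1 := by
  simp only [bayesFilter_eq, div_eq_mul_inv]
  rw [← Finset.sum_mul]
  exact ENNReal.mul_inv_cancel (hD t) (bayesEvidence_ne_top f₀ f g y t)

end Filter

section Probability

variable {S O : Fin (n+1) → Type*} [∀ i, Fintype (S i)] [∀ i, Fintype (O i)]

/-- The event that the observations equal `y` is parametrised by the hidden paths. -/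
theorem prob_eq_sum_path (p : (∀ t, S t × O t) → ℝ≥0∞) (y : ∀ t, O t)
    (E : Set (∀ t, S t × O t)) (hE : ∀ ω ∈ E, ∀ i, (ω i).2 = y i) :
    prob p E = ∑ x : ∀ t, S t, E.indicator p fun t => (x t, y t) := by
  refine (Fintype.sum_of_injective (fun (x : ∀ t, S t) t => (x t, y t)) ?_ _ _ ?_
    fun _ => rfl).symm
  · intro x x' h
    funext t
    exact congrArg Prod.fst (congrFun h t)
  · intro ω hω
    refine Set.indicator_of_notMem (fun hmem => hω ⟨fun t => (ω t).1, ?_⟩) p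
    funext t
    exact Prod.ext rfl (hE ω hmem t).symm

variable (f₀ : PMF (S 0)) (f : ∀ t : Fin n, S t.castSucc → PMF (S t.succ))
  (g : ∀ t : Fin (n+1), S t → PMF (O t)) (y : ∀ t, O t)

theorem bayesEvidence_ne_zero
    (hpos : 0 < prob (hmmJoint f₀ f g) {ω | ∀ i, (ω i).2 = y i}) (t : Fin (n+1)) :
    bayesEvidence f₀ f g y t ≠ 0 := by
  rw [prob_eq_sum_path _ y {ω | ∀ i, (ω i).2 = y i} fun _ h => h] at hpos
  obtain ⟨x, -, hx⟩ := Finset.exists_ne_zero_of_sum_ne_zero hpos.ne'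
  rw [Set.indicator_of_mem (by simp)] at hx
  exact fun h => mul_bayesPredict_ne_zero f₀ f g y hx t
    (Finset.sum_eq_zero_iff.1 h (x t) (Finset.mem_univ _))

theorem prob_state_and_obs_eq (hD : ∀ t, bayesEvidence f₀ f g y t ≠ 0) (t : Fin (n+1)) (x : S t) :
    prob (hmmJoint f₀ f g) {ω | (ω t).1 = x ∧ ∀ i, (ω i).2 = y i} =
      (∏ t, bayesEvidence f₀ f g y t) * smoother f₀ f g y t x := by
  rw [smoother_eq_mul_backwardMessage, ← sum_path_through_eq_mul (filterKernel f₀ f g y)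
    (bayesFilter f₀ f g y) (backwardMessage f₀ f g y) (bayesFilter_succ f₀ f g y)
    (backwardMessage_last f₀ f g y) (backwardMessage_castSucc f₀ f g y) t x,
    prob_eq_sum_path _ y _ fun _ h => h.2, Finset.mul_sum]
  refine Finset.sum_congr rfl fun p _ => ?_
  simp [Set.indicator_apply, hmmJoint_eq_prod_bayesEvidence_mul f₀ f g y hD]

theorem prob_obs_eq_prod_bayesEvidence (hD : ∀ t, bayesEvidence f₀ f g y t ≠ 0) :
    prob (hmmJoint f₀ f g) {ω | ∀ i, (ω i).2 = y i} = ∏ t, bayesEvidence f₀ f g y t := by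
  have h : ∑ x, prob (hmmJoint f₀ f g) {ω | (ω (Fin.last n)).1 = x ∧ ∀ i, (ω i).2 = y i} =
      ∏ t, bayesEvidence f₀ f g y t := by
    simp_rw [prob_state_and_obs_eq f₀ f g y hD, smoother_last]
    rw [← Finset.mul_sum, sum_bayesFilter_eq_one f₀ f g y hD, mul_one]
  rw [← h]
  simp only [prob]
  rw [Finset.sum_comm]
  refine Finset.sum_congr rfl fun ω _ => ?_
  simp [Set.indicator_apply, ite_and]

end Probability

/-- **Correctness of the instantiated fixed-interval smoother in `FinStoch`**: if the full
observation sequence has positive probability, then for every `t` and `x`,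
`ŝ_t(x) = P(X_t = x | Y_0 = y_0, …, Y_n = y_n)`. -/
theorem smoother_eq_condProb
    (f₀ : PMF (X 0)) (f : ∀ t : Fin n, X t.castSucc → PMF (X t.succ))
    (g : ∀ t : Fin (n+1), X t → PMF (Y t)) (y : ∀ t, Y t)
    (hpos : 0 < prob (hmmJoint f₀ f g) {ω | ∀ i, (ω i).2 = y i}) :
    ∀ (t : Fin (n+1)) (x : X t),
      smoother f₀ f g y t x =
        prob (hmmJoint f₀ f g) {ω | (ω t).1 = x ∧ ∀ i, (ω i).2 = y i} /
          prob (hmmJoint f₀ f g) {ω | ∀ i, (ω i).2 = y i} := by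
  have hD := bayesEvidence_ne_zero f₀ f g y hpos
  intro t x
  rw [prob_state_and_obs_eq f₀ f g y hD, prob_obs_eq_prod_bayesEvidence f₀ f g y hD]
  refine (ENNReal.eq_div_iff (Finset.prod_ne_zero_iff.2 fun t _ => hD t) ?_).2 rfl
  exact ENNReal.prod_ne_top fun t _ => bayesEvidence_ne_top f₀ f g y t

end DiscreteHMM
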